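/- Let X be an infinite set and let ζ, η be cardinals with ζ = 1 or ℵ₀ ≤ ζ ≤ (#X)⁺, with 1 ≤ η ≤ (#X)⁺ and η ≤ ζ. Then the relation λ_ζ^η on P_X, defined by (α,β) ∈ λ_ζ^η iff α = β or (rank(α) < η and rank(β) < η and #(ᾱ △ β̄) < ζ), is a congruence on P_X; and dually the relation ρ_ζ^η, defined by (α,β) ∈ ρ_ζ^η iff α = β or (rank(α) < η and rank(β) < η and #(α̲ △ β̲) < ζ), is a congruence on P_X. (Lemma 4.7.) -/

import Mathlib

open Cardinal
open scoped symmDiff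

namespace PartitionCongruences

variable {X : Type*}

/-- A partition over `X` is a setoid on `X ⊕ X`; `PMon X` is the carrier of the
partition monoid. -/
abbrev PMon (X : Type*) := Setoid (X ⊕ X)

/-- The set of blocks of a partition. -/
def cl (α : PMon X) : Set (Set (X ⊕ X)) := α.classes

/-- A block of `α` is a transversal if it meets both summands. -/
def IsTransversal (α : PMon X) (B : Set (X ⊕ X)) : Prop :=
  B ∈ α.classes ∧ (∃ x : X, Sum.inl x ∈ B) ∧ (∃ x : X, Sum.inr x ∈ B)

/-- The rank of a partition: the number of its transversals. -/
def rank (α : PMon X) : Cardinal :=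
  #{B : Set (X ⊕ X) // IsTransversal α B}

/-- The kernel partition `ᾱ`. -/
def ker (α : PMon X) : Set (Set X) := (Setoid.comap Sum.inl α).classes

/-- The cokernel partition `α̲`. -/
def coker (α : PMon X) : Set (Set X) := (Setoid.comap Sum.inr α).classes

/-- Left summand to top copy, right summand to middle copy. -/
def dmap (X : Type*) : X ⊕ X → X ⊕ (X ⊕ X) :=
  Sum.elim Sum.inl (fun x => Sum.inr (Sum.inl x))

/-- Left summand to middle copy, right summand to bottom copy. -/
def umap (X : Type*) : X ⊕ X → X ⊕ (X ⊕ X) :=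
  Sum.elim (fun x => Sum.inr (Sum.inl x)) (fun x => Sum.inr (Sum.inr x))

/-- Left summand to top copy, right summand to bottom copy. -/
def emap (X : Type*) : X ⊕ X → X ⊕ (X ⊕ X) :=
  Sum.elim Sum.inl (fun x => Sum.inr (Sum.inr x))

/-- The pushforward of a setoid along a map: the smallest setoid relating `f x` and
`f y` whenever `σ` relates `x` and `y`. -/
def push {A B : Type*} (f : A → B) (σ : Setoid A) : Setoid B :=
  Relation.EqvGen.setoid (fun a b => ∃ x y, σ x y ∧ f x = a ∧ f y = b)

/-- The product of the partition monoid. -/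
instance : Mul (PMon X) :=
  ⟨fun α β => Setoid.comap (emap X) (push (dmap X) α ⊔ push (umap X) β)⟩


/-- The setoid on three copies of `X` whose restriction to the outer copies is `α * β`. -/
def productGraph (α β : PMon X) : Setoid (X ⊕ (X ⊕ X)) :=
  push (dmap X) α ⊔ push (umap X) β

theorem push_le_iff {A B : Type*} (f : A → B) (σ : Setoid A) (s : Setoid B) :
    push f σ ≤ s ↔ σ ≤ Setoid.comap f s := by
  constructor
  · intro h x y hxy
    exact h (Relation.EqvGen.rel _ _ ⟨x, y, hxy, rfl, rfl⟩)
  · intro h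
    apply Setoid.eqvGen_le
    rintro _ _ ⟨x, y, hxy, rfl, rfl⟩
    exact h hxy

theorem productGraph_le_iff (α β : PMon X) (s : Setoid (X ⊕ (X ⊕ X))) :
    productGraph α β ≤ s ↔
      α ≤ Setoid.comap (dmap X) s ∧ β ≤ Setoid.comap (umap X) s := by
  rw [productGraph, sup_le_iff, push_le_iff, push_le_iff]

theorem productGraph_of_left {α β : PMon X} {a b : X ⊕ X} (h : α a b) :
    productGraph α β (dmap X a) (dmap X b) :=
  ((productGraph_le_iff α β _).1 le_rfl).1 h

theorem productGraph_of_right {α β : PMon X} {a b : X ⊕ X} (h : β a b) :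
    productGraph α β (umap X a) (umap X b) :=
  ((productGraph_le_iff α β _).1 le_rfl).2 h

/-- A set saturated for both factors is saturated for the product graph. -/
theorem mem_of_productGraph {α β : PMon X} {S : Set (X ⊕ (X ⊕ X))}
    (hα : ∀ a b, α a b → dmap X a ∈ S → dmap X b ∈ S)
    (hβ : ∀ a b, β a b → umap X a ∈ S → umap X b ∈ S)
    {a b : X ⊕ (X ⊕ X)} (h : productGraph α β a b) (ha : a ∈ S) : b ∈ S := by
  have hle : productGraph α β ≤ Setoid.ker (· ∈ S) :=
    (productGraph_le_iff α β _).2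
      ⟨fun a b hab => propext ⟨hα a b hab, hα b a (α.symm hab)⟩,
        fun a b hab => propext ⟨hβ a b hab, hβ b a (β.symm hab)⟩⟩
  exact (hle h : (a ∈ S) = (b ∈ S)).mp ha

theorem eq_setOf_rel {A : Type*} {r : Setoid A} {B : Set A} (hB : B ∈ r.classes) {a : A}
    (ha : a ∈ B) : B = {x | r x a} :=
  Setoid.eq_of_mem_classes hB ha (r.mem_classes a) (r.refl a)

theorem rel_of_mem_class {A : Type*} {r : Setoid A} {B : Set A} (hB : B ∈ r.classes) {a b : A}
    (ha : a ∈ B) (hb : b ∈ B) : r a b :=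
  Setoid.rel_iff_exists_classes r |>.2 ⟨B, hB, ha, hb⟩

theorem class_eq_of_rel {A : Type*} {r : Setoid A} {B C : Set A} (hB : B ∈ r.classes)
    (hC : C ∈ r.classes) {a b : A} (ha : a ∈ B) (hb : b ∈ C) (hab : r a b) : B = C :=
  Setoid.eq_of_mem_classes hB ha hC (eq_setOf_rel hC hb ▸ hab)

theorem mk_le_of_rel.{u} {A B : Type u} (R : A → B → Prop) (tot : ∀ a, ∃ b, R a b)
    (inj : ∀ a₁ a₂ b, R a₁ b → R a₂ b → a₁ = a₂) : #A ≤ #B := by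
  choose f hf using tot
  exact Cardinal.mk_le_of_injective (f := f) fun a₁ a₂ h => inj a₁ a₂ _ (hf a₁) (h ▸ hf a₂)

/-- A transversal of the product contains, in the product graph, a transversal of the
second factor. -/
theorem rank_mul_le_right (γ α : PMon X) : rank (γ * α) ≤ rank α := by
  refine mk_le_of_rel (fun T T' => ∃ p ∈ T'.1, ∃ q ∈ T.1,
    productGraph γ α (umap X p) (emap X q)) ?_ ?_
  · rintro ⟨T, hT, ⟨x, hx⟩, y, hy⟩
    by_contra! hno
    have key : ∀ m z : X, productGraph γ α (Sum.inr (Sum.inl m)) (Sum.inl x) →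
        ¬ α (Sum.inl m) (Sum.inr z) := fun m z hm hmz =>
      hno ⟨{a | α a (Sum.inl m)}, α.mem_classes _, ⟨m, α.refl _⟩, z, α.symm hmz⟩
        (Sum.inl m) (α.refl _) (Sum.inl x) hx hm
    have hxy : productGraph γ α (Sum.inr (Sum.inr y)) (Sum.inl x) :=
      rel_of_mem_class hT hy hx
    have hx' : (Sum.inl x : X ⊕ (X ⊕ X)) ∈
        {c | ∃ z, c = Sum.inr (Sum.inr z) ∧ productGraph γ α c (Sum.inl x)} := by
      refine mem_of_productGraph (α := γ) (β := α) ?_ ?_ hxy ⟨y, rfl, hxy⟩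
      · rintro (a | a) b - ⟨z, hz, -⟩ <;> simp [dmap] at hz
      · rintro (a | a) (b | b) hab ⟨z, hz, hJ⟩
        · simp [umap] at hz
        · simp [umap] at hz
        · exact absurd (α.symm hab) (key b a
            ((productGraph γ α).trans (productGraph_of_right (α.symm hab)) hJ))
        · exact ⟨b, rfl, (productGraph γ α).trans (productGraph_of_right (α.symm hab)) hJ⟩
    obtain ⟨z, hz, -⟩ := hx'
    simp at hz
  · rintro ⟨T₁, hT₁⟩ ⟨T₂, hT₂⟩ ⟨T', hT'⟩ ⟨p, hp, q, hq, h⟩ ⟨p', hp', q', hq', k⟩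
    exact Subtype.ext (class_eq_of_rel hT₁.1 hT₂.1 hq hq'
      ((productGraph γ α).trans ((productGraph γ α).symm h) ((productGraph γ α).trans
        (productGraph_of_right (rel_of_mem_class hT'.1 hp hp')) k)))

/-- The involution of the partition monoid, swapping the two copies of `X`. -/
def involute (α : PMon X) : PMon X := Setoid.comap Sum.swap α

theorem involute_rel (α : PMon X) (a b : X ⊕ X) : involute α a b ↔ α a.swap b.swap := Iff.rfl

theorem involute_involute (α : PMon X) : involute (involute α) = α := by
  ext a b
  simp [involute_rel]

theorem involute_injective : Function.Injective (involute : PMon X → PMon X) :=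
  Function.LeftInverse.injective involute_involute

theorem ker_involute (α : PMon X) : ker (involute α) = coker α := rfl

/-- Exchanges the top and bottom copies of `X`. -/
def flipCopies : X ⊕ (X ⊕ X) → X ⊕ (X ⊕ X) :=
  Sum.elim (fun x => Sum.inr (Sum.inr x))
    (Sum.elim (fun x => Sum.inr (Sum.inl x)) Sum.inl)

theorem flipCopies_dmap (a : X ⊕ X) : flipCopies (dmap X a) = umap X a.swap := by
  cases a <;> rfl

theorem flipCopies_umap (a : X ⊕ X) : flipCopies (umap X a) = dmap X a.swap := by
  cases a <;> rfl

theorem flipCopies_emap (a : X ⊕ X) : flipCopies (emap X a) = emap X a.swap := by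
  cases a <;> rfl

theorem productGraph_flipCopies {α β : PMon X} {a b : X ⊕ (X ⊕ X)} (h : productGraph α β a b) :
    productGraph (involute β) (involute α) (flipCopies a) (flipCopies b) := by
  refine (productGraph_le_iff α β (Setoid.comap flipCopies (productGraph (involute β) (involute α)))).2
    ⟨fun {c d} hcd => ?_, fun {c d} hcd => ?_⟩ h
  · simp only [Setoid.comap_rel, flipCopies_dmap]
    apply productGraph_of_right
    simpa [involute_rel] using hcd
  · simp only [Setoid.comap_rel, flipCopies_umap]
    apply productGraph_of_left
    simpa [involute_rel] using hcd

theorem involute_mul_rel {α β : PMon X} {a b : X ⊕ X} (h : (α * β) a b) :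
    (involute β * involute α) a.swap b.swap := by
  have := productGraph_flipCopies h
  rwa [flipCopies_emap, flipCopies_emap] at this

theorem involute_mul (α β : PMon X) : involute (α * β) = involute β * involute α := by
  ext a b
  constructor
  · intro h
    simpa using involute_mul_rel (h : (α * β) a.swap b.swap)
  · intro h
    have := involute_mul_rel h
    rwa [involute_involute, involute_involute] at this

theorem rank_involute_le (α : PMon X) : rank (involute α) ≤ rank α := by
  refine mk_le_of_rel (fun T T' => T'.1 = Sum.swap ⁻¹' T.1) ?_ ?_
  · rintro ⟨T, ⟨c, rfl⟩, ⟨x, hx⟩, y, hy⟩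
    refine ⟨⟨_, ⟨c.swap, ?_⟩, ⟨y, ?_⟩, x, ?_⟩, rfl⟩
    · ext d
      change involute α d.swap c ↔ α d c.swap
      simp [involute_rel]
    · exact hy
    · exact hx
  · rintro ⟨T₁, hT₁⟩ ⟨T₂, hT₂⟩ T' h₁ h₂
    exact Subtype.ext (Set.preimage_injective.2 Sum.swap_leftInverse.surjective (h₁.symm.trans h₂))

theorem rank_involute (α : PMon X) : rank (involute α) = rank α :=
  (rank_involute_le α).antisymm (by simpa [involute_involute] using rank_involute_le (involute α))

theorem rank_mul_le_left (α γ : PMon X) : rank (α * γ) ≤ rank α := by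
  rw [← rank_involute (α * γ), ← rank_involute α, involute_mul]
  exact rank_mul_le_right _ _

/-- Upper blocks of `α` that are not in a transversal are unaffected by right
multiplication. -/
theorem mul_rel_inl_iff_of_not_transversal {α : PMon X} (γ : PMon X) {x : X}
    (hx : ∀ z, ¬ α (Sum.inl x) (Sum.inr z)) (y : X) :
    (α * γ) (Sum.inl y) (Sum.inl x) ↔ α (Sum.inl y) (Sum.inl x) := by
  refine ⟨fun h => ?_, fun h => productGraph_of_left h⟩
  have hy : (Sum.inl y : X ⊕ (X ⊕ X)) ∈
      {c | ∃ w, c = Sum.inl w ∧ α (Sum.inl w) (Sum.inl x)} := by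
    refine mem_of_productGraph (α := α) (β := γ) ?_ ?_ ((productGraph α γ).symm h)
      ⟨x, rfl, α.refl _⟩
    · rintro (a | a) (b | b) hab ⟨w, hw, hwx⟩
      · obtain rfl : a = w := Sum.inl_injective hw
        exact ⟨b, rfl, α.trans (α.symm hab) hwx⟩
      · obtain rfl : a = w := Sum.inl_injective hw
        exact absurd (α.trans (α.symm hwx) hab) (hx b)
      · simp [dmap] at hw
      · simp [dmap] at hw
    · rintro (a | a) b - ⟨z, hz, -⟩ <;> simp [umap] at hz
  obtain ⟨w, hw, hwx⟩ := hy
  obtain rfl : y = w := Sum.inl_injective hw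
  exact hwx

theorem exists_of_ker_class_ne {α γ : PMon X} {x : X}
    (h : {y | Setoid.comap Sum.inl α y x} ≠ {y | Setoid.comap Sum.inl (α * γ) y x}) :
    ∃ z, α (Sum.inl x) (Sum.inr z) := by
  by_contra! hx
  exact h (Set.ext fun y => (mul_rel_inl_iff_of_not_transversal γ hx y).symm)

theorem mk_ker_diff_ker_mul_le (α γ : PMon X) :
    #↥(ker α \ ker (α * γ)) ≤ rank α := by
  refine mk_le_of_rel (fun K T => ∃ x ∈ K.1, Sum.inl x ∈ T.1) ?_ ?_
  · rintro ⟨K, ⟨x, rfl⟩, hK⟩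
    obtain ⟨z, hz⟩ := exists_of_ker_class_ne (α := α) (γ := γ) (x := x)
      fun h => hK (h ▸ Setoid.mem_classes _ x)
    exact ⟨⟨{a | α a (Sum.inl x)}, α.mem_classes _, ⟨x, α.refl _⟩, z, α.symm hz⟩,
      x, α.refl _, α.refl _⟩
  · rintro ⟨K₁, hK₁, _⟩ ⟨K₂, hK₂, _⟩ ⟨T, hT⟩ ⟨x, hx, hxT⟩ ⟨y, hy, hyT⟩
    exact Subtype.ext (class_eq_of_rel hK₁ hK₂ hx hy (rel_of_mem_class hT.1 hxT hyT))

theorem mk_ker_mul_diff_ker_le (α γ : PMon X) :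
    #↥(ker (α * γ) \ ker α) ≤ rank α := by
  refine mk_le_of_rel (fun K T => ∃ x ∈ K.1, Sum.inl x ∈ T.1) ?_ ?_
  · rintro ⟨K, ⟨x, rfl⟩, hK⟩
    obtain ⟨z, hz⟩ := exists_of_ker_class_ne (α := α) (γ := γ) (x := x)
      fun h => hK (h ▸ Setoid.mem_classes _ x)
    exact ⟨⟨{a | α a (Sum.inl x)}, α.mem_classes _, ⟨x, α.refl _⟩, z, α.symm hz⟩,
      x, (α * γ).refl _, α.refl _⟩
  · rintro ⟨K₁, hK₁, _⟩ ⟨K₂, hK₂, _⟩ ⟨T, hT⟩ ⟨x, hx, hxT⟩ ⟨y, hy, hyT⟩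
    exact Subtype.ext (class_eq_of_rel hK₁ hK₂ hx hy
      (productGraph_of_left (rel_of_mem_class hT.1 hxT hyT)))

theorem mk_symmDiff_le {A : Type*} (s t : Set A) :
    #↥(s ∆ t) ≤ #↥(s \ t) + #↥(t \ s) :=
  Cardinal.mk_union_le _ _

theorem mk_symmDiff_triangle {A : Type*} (s t u : Set A) :
    #↥(s ∆ u) ≤ #↥(s ∆ t) + #↥(t ∆ u) :=
  (Cardinal.mk_le_mk_of_subset (symmDiff_triangle s t u)).trans (Cardinal.mk_union_le _ _)

theorem dmap_injective : Function.Injective (dmap X) := by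
  rintro (a | a) (b | b) h <;> simp_all [dmap]

/-- If the kernels of `α` and `β` agree on the component of `x` in the product graph of
`γ` and `α`, then `γ * α` and `γ * β` have the same kernel class at `x`. -/
theorem mul_rel_inl_iff_of_ker_agree {γ α β : PMon X} {x : X}
    (H : ∀ m m', productGraph γ α (Sum.inl x) (Sum.inr (Sum.inl m)) →
      (α (Sum.inl m) (Sum.inl m') ↔ β (Sum.inl m) (Sum.inl m'))) (y : X) :
    (γ * α) (Sum.inl x) (Sum.inl y) ↔ (γ * β) (Sum.inl x) (Sum.inl y) := by
  let C (a : X ⊕ X) : Prop := productGraph γ α (Sum.inl x) (dmap X a) ∧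
    productGraph γ β (Sum.inl x) (dmap X a)
  have hγ : ∀ a b, γ a b → C a → C b := fun a b hab h =>
    ⟨(productGraph γ α).trans h.1 (productGraph_of_left hab),
      (productGraph γ β).trans h.2 (productGraph_of_left hab)⟩
  have hm : ∀ m m', C (Sum.inr m) → α (Sum.inl m) (Sum.inl m') → C (Sum.inr m') :=
    fun m m' h hmm =>
      ⟨(productGraph γ α).trans h.1 (productGraph_of_right hmm),
        (productGraph γ β).trans h.2 (productGraph_of_right ((H m m' h.1).1 hmm))⟩
  have key : ∀ δ : PMon X, (∀ m m', C (Sum.inr m) → δ (Sum.inl m) (Sum.inl m') →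
      C (Sum.inr m')) → ∀ y, (γ * δ) (Sum.inl x) (Sum.inl y) → C (Sum.inl y) := by
    intro δ hδ y hy
    have hmem : (Sum.inl y : X ⊕ (X ⊕ X)) ∈
        {c | (∃ a, c = dmap X a ∧ C a) ∨
          ∃ z m, c = Sum.inr (Sum.inr z) ∧ C (Sum.inr m) ∧ δ (Sum.inl m) (Sum.inr z)} := by
      refine mem_of_productGraph (α := γ) (β := δ) ?_ ?_ hy
        (Or.inl ⟨Sum.inl x, rfl, (productGraph γ α).refl _, (productGraph γ β).refl _⟩)
      · rintro a b hab (⟨a', ha, hC⟩ | ⟨z, m, hz, -⟩)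
        · obtain rfl : a = a' := dmap_injective ha
          exact Or.inl ⟨b, rfl, hγ a b hab hC⟩
        · rcases a with a | a <;> simp [dmap] at hz
      · have hsplit : ∀ a, umap X a ∈ {c | (∃ a, c = dmap X a ∧ C a) ∨
            ∃ z m, c = Sum.inr (Sum.inr z) ∧ C (Sum.inr m) ∧ δ (Sum.inl m) (Sum.inr z)} ↔
            ∃ m, C (Sum.inr m) ∧ δ (Sum.inl m) a := by
          intro a
          constructor
          · rintro (⟨a', ha, hC⟩ | ⟨z, m, hz, hC, hmz⟩)
            · rcases a with a | a <;> rcases a' with a' | a' <;> simp [umap, dmap] at ha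
              subst ha
              exact ⟨a, hC, δ.refl _⟩
            · rcases a with a | a <;> simp [umap] at hz
              subst hz
              exact ⟨m, hC, hmz⟩
          · rintro ⟨m, hC, hma⟩
            rcases a with a | a
            · exact Or.inl ⟨Sum.inr a, rfl, hδ m a hC hma⟩
            · exact Or.inr ⟨a, m, rfl, hC, hma⟩
        intro a b hab ha
        obtain ⟨m, hC, hma⟩ := (hsplit a).1 ha
        exact (hsplit b).2 ⟨m, hC, δ.trans hma hab⟩
    obtain ⟨a, ha, hC⟩ | ⟨z, m, hz, -⟩ := hmem
    · obtain rfl : Sum.inl y = a := dmap_injective ha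
      exact hC
    · simp at hz
  exact ⟨fun h => (key α hm y h).2,
    fun h => (key β (fun m m' hC hmm => hm m m' hC ((H m m' hC.1).2 hmm)) y h).1⟩

theorem mk_ker_mul_diff_ker_mul_le (γ α β : PMon X) :
    #↥(ker (γ * α) \ ker (γ * β)) ≤ #↥(ker α \ ker β) := by
  refine mk_le_of_rel (fun K L => ∃ x ∈ K.1, ∃ m ∈ L.1,
    productGraph γ α (Sum.inl x) (Sum.inr (Sum.inl m))) ?_ ?_
  · rintro ⟨K, ⟨x, rfl⟩, hK⟩
    by_contra! hno
    refine hK ⟨x, Set.ext fun y => ?_⟩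
    have := mul_rel_inl_iff_of_ker_agree (γ := γ) (α := α) (β := β) (x := x) ?_ y
    · exact ⟨fun h => (γ * β).symm (this.1 ((γ * α).symm h)),
        fun h => (γ * α).symm (this.2 ((γ * β).symm h))⟩
    · intro m m' hm
      have hL : {a | Setoid.comap Sum.inl α a m} ∈ ker β := by
        by_contra hL
        exact hno ⟨_, Setoid.mem_classes _ m, hL⟩ x ((γ * α).refl _) m (α.refl _) hm
      have heq := eq_setOf_rel hL (a := m) (α.refl _)
      have hiff : α (Sum.inl m') (Sum.inl m) ↔ β (Sum.inl m') (Sum.inl m) :=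
        Set.ext_iff.1 heq m'
      exact ⟨fun h => β.symm (hiff.1 (α.symm h)), fun h => α.symm (hiff.2 (β.symm h))⟩
  · rintro ⟨K₁, hK₁, _⟩ ⟨K₂, hK₂, _⟩ ⟨L, hL, _⟩ ⟨x, hx, m, hm, h⟩ ⟨x', hx', m', hm', k⟩
    have hmm : α (Sum.inl m) (Sum.inl m') := rel_of_mem_class hL hm hm'
    exact Subtype.ext (class_eq_of_rel hK₁ hK₂ hx hx'
      ((productGraph γ α).trans h ((productGraph γ α).trans (productGraph_of_right hmm)
        ((productGraph γ α).symm k))))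

/-- Sums of two cardinals below `ζ` stay below `ζ`. -/
theorem add_lt_of_eq_one_or_aleph0_le {ζ a b : Cardinal} (hζ : ζ = 1 ∨ ℵ₀ ≤ ζ)
    (ha : a < ζ) (hb : b < ζ) : a + b < ζ := by
  rcases hζ with rfl | hζ
  · rw [Cardinal.lt_one_iff] at ha hb
    simp [ha, hb]
  · exact Cardinal.add_lt_of_lt hζ ha hb

/-- The relation `λ_ζ^η`. -/
def LambdaRel (ζ η : Cardinal) (α β : PMon X) : Prop :=
  α = β ∨ (rank α < η ∧ rank β < η ∧ #↥(ker α ∆ ker β) < ζ)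

theorem lambdaRel_equivalence {ζ : Cardinal} (η : Cardinal) (hζ : ζ = 1 ∨ ℵ₀ ≤ ζ) :
    Equivalence (LambdaRel (X := X) ζ η) where
  refl _ := Or.inl rfl
  symm := by
    rintro α β (rfl | ⟨h₁, h₂, h₃⟩)
    · exact Or.inl rfl
    · exact Or.inr ⟨h₂, h₁, by rwa [symmDiff_comm]⟩
  trans := by
    rintro α β γ (rfl | ⟨h₁, h₂, h₃⟩) (rfl | ⟨k₁, k₂, k₃⟩)
    · exact Or.inl rfl
    · exact Or.inr ⟨k₁, k₂, k₃⟩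
    · exact Or.inr ⟨h₁, h₂, h₃⟩
    · exact Or.inr ⟨h₁, k₂, (mk_symmDiff_triangle _ (ker β) _).trans_lt
        (add_lt_of_eq_one_or_aleph0_le hζ h₃ k₃)⟩

theorem LambdaRel.mul_left {ζ η : Cardinal} (hζ : ζ = 1 ∨ ℵ₀ ≤ ζ) (γ : PMon X) {α β : PMon X}
    (h : LambdaRel ζ η α β) : LambdaRel ζ η (γ * α) (γ * β) := by
  obtain rfl | ⟨h₁, h₂, h₃⟩ := h
  · exact Or.inl rfl
  · refine Or.inr ⟨(rank_mul_le_right γ α).trans_lt h₁, (rank_mul_le_right γ β).trans_lt h₂,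
      (mk_symmDiff_le _ _).trans_lt (add_lt_of_eq_one_or_aleph0_le hζ ?_ ?_)⟩
    · exact ((mk_ker_mul_diff_ker_mul_le γ α β).trans
        (Cardinal.mk_le_mk_of_subset Set.subset_union_left)).trans_lt h₃
    · exact ((mk_ker_mul_diff_ker_mul_le γ β α).trans
        (Cardinal.mk_le_mk_of_subset Set.subset_union_right)).trans_lt h₃

theorem LambdaRel.mul_right {ζ η : Cardinal} (hζ : ζ = 1 ∨ ℵ₀ ≤ ζ) (hηζ : η ≤ ζ) (γ : PMon X)
    {α β : PMon X} (h : LambdaRel ζ η α β) : LambdaRel ζ η (α * γ) (β * γ) := by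
  obtain rfl | ⟨h₁, h₂, h₃⟩ := h
  · exact Or.inl rfl
  · have key : ∀ δ : PMon X, rank δ < η → LambdaRel ζ η (δ * γ) δ := fun δ hδ =>
      Or.inr ⟨(rank_mul_le_left δ γ).trans_lt hδ, hδ, (mk_symmDiff_le _ _).trans_lt
        (add_lt_of_eq_one_or_aleph0_le hζ
          ((mk_ker_mul_diff_ker_le δ γ).trans_lt (hδ.trans_le hηζ))
          ((mk_ker_diff_ker_mul_le δ γ).trans_lt (hδ.trans_le hηζ)))⟩
    have e := lambdaRel_equivalence (X := X) η hζ
    exact e.trans (key α h₁) (e.trans (Or.inr ⟨h₁, h₂, h₃⟩) (e.symm (key β h₂)))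

/-- The congruence `λ_ζ^η`. -/
def lambdaCon {ζ η : Cardinal} (hζ : ζ = 1 ∨ ℵ₀ ≤ ζ) (hηζ : η ≤ ζ) : Con (PMon X) where
  r := LambdaRel ζ η
  iseqv := lambdaRel_equivalence η hζ
  mul' h₁ h₂ := (lambdaRel_equivalence η hζ).trans (h₁.mul_right hζ hηζ _) (h₂.mul_left hζ _)

/-- The image of a congruence under the involution `involute`. -/
def involuteCon (c : Con (PMon X)) : Con (PMon X) where
  toSetoid := Setoid.comap involute c.toSetoid
  mul' {α β γ δ} h₁ h₂ := by
    change c (involute (α * γ)) (involute (β * δ))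
    rw [involute_mul, involute_mul]
    exact c.mul h₂ h₁

/-- Lemma 4.7: for an infinite set `X` and cardinals `ζ`, `η` with `ζ = 1` or
`ℵ₀ ≤ ζ ≤ (#X)⁺`, `1 ≤ η ≤ (#X)⁺` and `η ≤ ζ`, the relations `λ_ζ^η` and `ρ_ζ^η`
are congruences on the partition monoid `P_X`. -/
theorem lambda_rho_isCongruence [Infinite X] (ζ η : Cardinal)
    (hζ : ζ = 1 ∨ (ℵ₀ ≤ ζ ∧ ζ ≤ Order.succ #X))
    (hη₁ : 1 ≤ η) (hη₂ : η ≤ Order.succ #X) (hηζ : η ≤ ζ) :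
    (∃ c : Con (PMon X), ∀ α β : PMon X,
      c α β ↔ (α = β ∨ (rank α < η ∧ rank β < η ∧ #↥(ker α ∆ ker β) < ζ))) ∧
    (∃ c : Con (PMon X), ∀ α β : PMon X,
      c α β ↔ (α = β ∨ (rank α < η ∧ rank β < η ∧ #↥(coker α ∆ coker β) < ζ))) := by
  have hζ' : ζ = 1 ∨ ℵ₀ ≤ ζ := hζ.imp_right And.left
  refine ⟨⟨lambdaCon hζ' hηζ, fun α β => Iff.rfl⟩,
    ⟨involuteCon (lambdaCon hζ' hηζ), fun α β => ?_⟩⟩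
  change LambdaRel ζ η (involute α) (involute β) ↔ _
  rw [LambdaRel, involute_injective.eq_iff, rank_involute, rank_involute, ker_involute, ker_involute]

end PartitionCongruences
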